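/- Let G be a finite simple very well-covered graph containing no cycle of length four. Then G has a unique maximum matching, and consequently Ψ(G) is a greedoid on V(G). -/

import Mathlib

open Classical

variable {V : Type*} [Fintype V] [DecidableEq V]

/-- `S` is a stable (independent) set of vertices in `G`. -/
def IsStable (G : SimpleGraph V) (S : Finset V) : Prop :=
  ∀ ⦃x⦄, x ∈ S → ∀ ⦃y⦄, y ∈ S → ¬G.Adj x y

/-- The open neighborhood `N(S)`: vertices outside `S` having a neighbor in `S`. -/
noncomputable def nbhd (G : SimpleGraph V) (S : Finset V) : Finset V :=
  Finset.univ.filter fun v => v ∉ S ∧ ∃ u ∈ S, G.Adj u v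

/-- The closed neighborhood `N[S] = S ∪ N(S)`. -/
noncomputable def closedNbhd (G : SimpleGraph V) (S : Finset V) : Finset V :=
  S ∪ nbhd G S

/-- The stability (independence) number of the subgraph of `G` induced by `A`. -/
noncomputable def alphaOn (G : SimpleGraph V) (A : Finset V) : ℕ :=
  sSup {n | ∃ S ⊆ A, IsStable G S ∧ S.card = n}

/-- The stability (independence) number `α(G)`. -/
noncomputable def alpha (G : SimpleGraph V) : ℕ :=
  alphaOn G Finset.univ

/-- `S` is a maximum stable set of the subgraph of `G` induced by `N[S]`. -/
def IsLocalMaxStable (G : SimpleGraph V) (S : Finset V) : Prop :=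
  IsStable G S ∧ S.card = alphaOn G (closedNbhd G S)

/-- `Ψ(G)`: the family of all local maximum stable sets of `G`. -/
def Psi (G : SimpleGraph V) : Set (Finset V) :=
  {S | IsLocalMaxStable G S}

/-- A matching of `G`: a set of pairwise disjoint edges of `G`. -/
def IsGMatching (G : SimpleGraph V) (M : Finset (Sym2 V)) : Prop :=
  (∀ e ∈ M, e ∈ G.edgeSet) ∧
    ∀ e ∈ M, ∀ f ∈ M, e ≠ f → ∀ v : V, v ∈ e → v ∉ f

/-- A matching of `G` all of whose edges have both endpoints inside `A`,
i.e. a matching of the subgraph of `G` induced by `A`. -/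
def IsGMatchingOn (G : SimpleGraph V) (A : Finset V) (M : Finset (Sym2 V)) : Prop :=
  IsGMatching G M ∧ ∀ e ∈ M, ∀ v : V, v ∈ e → v ∈ A

/-- The matching number of the subgraph of `G` induced by `A`. -/
noncomputable def muOn (G : SimpleGraph V) (A : Finset V) : ℕ :=
  sSup {n | ∃ M, IsGMatchingOn G A M ∧ M.card = n}

/-- The matching number `μ(G)`. -/
noncomputable def mu (G : SimpleGraph V) : ℕ :=
  muOn G Finset.univ

/-- A maximum matching of `G`. -/
def IsMaximumGMatching (G : SimpleGraph V) (M : Finset (Sym2 V)) : Prop :=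
  IsGMatching G M ∧ M.card = mu G

/-- The matching `M` saturates the vertex `v`. -/
def MSaturates (M : Finset (Sym2 V)) (v : V) : Prop :=
  ∃ e ∈ M, v ∈ e

/-- A perfect matching of `G`: a matching saturating every vertex. -/
def IsPerfectGMatching (G : SimpleGraph V) (M : Finset (Sym2 V)) : Prop :=
  IsGMatching G M ∧ ∀ v : V, MSaturates M v

/-- The set of vertices saturated by `M`. -/
noncomputable def msupp (M : Finset (Sym2 V)) : Finset V :=
  Finset.univ.filter fun v => ∃ e ∈ M, v ∈ e

/-- `M` is a uniquely restricted matching: it is the unique perfect matching of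
the subgraph of `G` induced by the set of vertices saturated by `M`. -/
def UniquelyRestricted (G : SimpleGraph V) (M : Finset (Sym2 V)) : Prop :=
  IsGMatching G M ∧
    ∀ M' : Finset (Sym2 V), IsGMatchingOn G (msupp M) M' →
      (∀ v ∈ msupp M, MSaturates M' v) → M' = M

/-- Accessibility property of a set system. -/
def AccessibleFam (F : Set (Finset V)) : Prop :=
  ∀ X ∈ F, X ≠ ∅ → ∃ x ∈ X, X.erase x ∈ F

/-- Exchange property of a set system. -/
def ExchangeFam (F : Set (Finset V)) : Prop :=
  ∀ X ∈ F, ∀ Y ∈ F, X.card = Y.card + 1 → ∃ x ∈ X, x ∉ Y ∧ insert x Y ∈ F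

/-- A greedoid: a nonempty set system satisfying accessibility and exchange. -/
def IsGreedoidFam (F : Set (Finset V)) : Prop :=
  F.Nonempty ∧ AccessibleFam F ∧ ExchangeFam F

/-- A maximal stable set. -/
def IsMaximalStable (G : SimpleGraph V) (S : Finset V) : Prop :=
  IsStable G S ∧ ∀ T, IsStable G T → S ⊆ T → S = T

/-- `G` is well-covered: all maximal stable sets have the same cardinality. -/
def WellCovered (G : SimpleGraph V) : Prop :=
  ∀ S T, IsMaximalStable G S → IsMaximalStable G T → S.card = T.card

/-- `G` is very well-covered: well-covered, no isolated vertices, `|V| = 2α(G)`. -/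
def VeryWellCovered (G : SimpleGraph V) : Prop :=
  WellCovered G ∧ (∀ v : V, ∃ u, G.Adj v u) ∧ Fintype.card V = 2 * alpha G

/-- The subgraph of `G` induced by `A` is a König-Egerváry graph. -/
def KonigEgervaryOn (G : SimpleGraph V) (A : Finset V) : Prop :=
  alphaOn G A + muOn G A = A.card

/-- `G` is a König-Egerváry graph: `α(G) + μ(G) = |V(G)|`. -/
def KonigEgervary (G : SimpleGraph V) : Prop :=
  alpha G + mu G = Fintype.card V

/-- The cycle `c` is alternating with respect to `M`: of every two incident
edges of `c` exactly one belongs to `M`. -/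
def IsAlternatingCycle (G : SimpleGraph V) (M : Finset (Sym2 V)) {v : V}
    (c : G.Walk v v) : Prop :=
  c.IsCycle ∧ ∀ e ∈ c.edges, ∀ f ∈ c.edges, e ≠ f →
    (∃ u : V, u ∈ e ∧ u ∈ f) → (e ∈ M ↔ f ∉ M)

/-- `G` contains an `M`-alternating cycle. -/
def HasAlternatingCycle (G : SimpleGraph V) (M : Finset (Sym2 V)) : Prop :=
  ∃ (v : V) (c : G.Walk v v), IsAlternatingCycle G M c

/-- The cycle `c` is chordless: the subgraph induced by its vertices has no
edges other than the cycle edges. -/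
def ChordlessCycle (G : SimpleGraph V) {v : V} (c : G.Walk v v) : Prop :=
  ∀ x ∈ c.support, ∀ y ∈ c.support, G.Adj x y → s(x, y) ∈ c.edges

section StableSets

variable {G : SimpleGraph V}

omit [Fintype V] [DecidableEq V] in
lemma IsStable.mono {S T : Finset V} (hT : IsStable G T) (h : S ⊆ T) : IsStable G S :=
  fun _ hx _ hy => hT (h hx) (h hy)

omit [Fintype V] [DecidableEq V] in
lemma bddAbove_stable_card (G : SimpleGraph V) (A : Finset V) :
    BddAbove {n | ∃ S ⊆ A, IsStable G S ∧ S.card = n} :=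
  ⟨A.card, by rintro n ⟨S, hS, -, rfl⟩; exact Finset.card_le_card hS⟩

omit [Fintype V] [DecidableEq V] in
lemma IsStable.card_le_alphaOn {A S : Finset V} (hS : IsStable G S) (h : S ⊆ A) :
    S.card ≤ alphaOn G A :=
  le_csSup (bddAbove_stable_card G A) ⟨S, h, hS, rfl⟩

omit [Fintype V] [DecidableEq V] in
lemma exists_stable_card_eq_alphaOn (G : SimpleGraph V) (A : Finset V) :
    ∃ S ⊆ A, IsStable G S ∧ S.card = alphaOn G A :=
  Nat.sSup_mem (s := {n | ∃ S ⊆ A, IsStable G S ∧ S.card = n})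
    ⟨0, ∅, by simp, by simp [IsStable], by simp⟩ (bddAbove_stable_card G A)

lemma IsStable.exists_maximal_superset {A : Finset V} (hA : IsStable G A) :
    ∃ S, A ⊆ S ∧ IsMaximalStable G S := by
  obtain ⟨S, hS, hmax⟩ := Finset.exists_max_image
    (Finset.univ.filter fun S => A ⊆ S ∧ IsStable G S) Finset.card ⟨A, by simp [hA]⟩
  simp only [Finset.mem_filter, Finset.mem_univ, true_and] at hS hmax
  exact ⟨S, hS.1, hS.2, fun T hT hST =>
    Finset.eq_of_subset_of_card_le hST (hmax T ⟨hS.1.trans hST, hT⟩)⟩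

omit [DecidableEq V] in
lemma WellCovered.card_eq_alpha (hG : WellCovered G) {S : Finset V} (hS : IsMaximalStable G S) :
    S.card = alpha G := by
  obtain ⟨T, -, hT, hTc⟩ := exists_stable_card_eq_alphaOn G Finset.univ
  rw [alpha, ← hTc]
  exact hG S T hS ⟨hT, fun U hU h => Finset.eq_of_subset_of_card_le h
    (hTc ▸ hU.card_le_alphaOn (Finset.subset_univ U))⟩

lemma WellCovered.exists_superset_card_eq_alpha (hG : WellCovered G) {A : Finset V}
    (hA : IsStable G A) : ∃ S, A ⊆ S ∧ IsStable G S ∧ S.card = alpha G := by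
  obtain ⟨S, hAS, hS⟩ := hA.exists_maximal_superset
  exact ⟨S, hAS, hS.1, hG.card_eq_alpha hS⟩

/-- Hall's condition for a stable set disjoint from a maximum stable set. -/
lemma card_le_card_neighbors_in_maximum {S B : Finset V} (hS : IsStable G S)
    (hSc : S.card = alpha G) (hB : IsStable G B) (hd : Disjoint B S) :
    B.card ≤ (S.filter fun v => ∃ u ∈ B, G.Adj u v).card := by
  have hst : IsStable G (B ∪ S.filter fun v => ¬∃ u ∈ B, G.Adj u v) := by
    intro x hx y hy hxy
    simp only [Finset.mem_union, Finset.mem_filter] at hx hy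
    rcases hx with hx | hx <;> rcases hy with hy | hy
    · exact hB hx hy hxy
    · exact hy.2 ⟨x, hx, hxy⟩
    · exact hx.2 ⟨y, hy, hxy.symm⟩
    · exact hS hx.1 hy.1 hxy
  have h1 := hst.card_le_alphaOn (Finset.subset_univ _)
  rw [Finset.card_union_of_disjoint (hd.mono_right (Finset.filter_subset _ _))] at h1
  have h2 := Finset.card_filter_add_card_filter_not (s := S) (fun v => ∃ u ∈ B, G.Adj u v)
  change _ ≤ alpha G at h1
  omega

/-- In a well-covered graph without isolated vertices, stable sets satisfy Hall's condition. -/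
lemma WellCovered.card_le_card_neighbors (hG : WellCovered G) (hiso : ∀ v, ∃ u, G.Adj v u)
    {A : Finset V} (hA : IsStable G A) :
    A.card ≤ (Finset.univ.filter fun v => ∃ u ∈ A, G.Adj u v).card := by
  induction A using Finset.strongInduction with
  | H A ih =>
    rcases A.eq_empty_or_nonempty with rfl | ⟨a, ha⟩
    · simp
    obtain ⟨t, hat⟩ := hiso a
    obtain ⟨S, htS, hS, hSc⟩ := hG.exists_superset_card_eq_alpha (A := {t})
      (by intro x hx y hy; simp_all)
    have haS : a ∉ S := fun h => hS h (htS (by simp)) hat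
    have h1 := ih (A ∩ S) ⟨Finset.inter_subset_left, fun h => haS (Finset.mem_inter.1 (h ha)).2⟩
      (hA.mono Finset.inter_subset_left)
    have h2 := card_le_card_neighbors_in_maximum hS hSc
      (hA.mono Finset.sdiff_subset) (Finset.sdiff_disjoint (s := S) (t := A))
    have hd : Disjoint (Finset.univ.filter fun v => ∃ u ∈ A ∩ S, G.Adj u v)
        (S.filter fun v => ∃ u ∈ A \ S, G.Adj u v) := by
      rw [Finset.disjoint_left]
      intro v hv hv'
      simp only [Finset.mem_filter, Finset.mem_inter] at hv hv'
      obtain ⟨-, u, hu, huv⟩ := hv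
      exact hS hu.2 hv'.1 huv
    have hsub : (Finset.univ.filter fun v => ∃ u ∈ A ∩ S, G.Adj u v) ∪
        (S.filter fun v => ∃ u ∈ A \ S, G.Adj u v) ⊆
        Finset.univ.filter fun v => ∃ u ∈ A, G.Adj u v := by
      intro v hv
      simp only [Finset.mem_union, Finset.mem_filter, Finset.mem_inter, Finset.mem_sdiff,
        Finset.mem_univ, true_and] at hv ⊢
      rcases hv with ⟨u, hu, h⟩ | ⟨-, u, hu, h⟩ <;> exact ⟨u, hu.1, h⟩
    have h3 := Finset.card_le_card hsub
    rw [Finset.card_union_of_disjoint hd] at h3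
    have h4 := Finset.card_inter_add_card_sdiff A S
    omega

end StableSets

/-- An involution describing a perfect matching of `G`. -/
structure IsPartner (G : SimpleGraph V) (f : V → V) : Prop where
  invol : ∀ v, f (f v) = v
  adj : ∀ v, G.Adj v (f v)

lemma VeryWellCovered.exists_isPartner {G : SimpleGraph V} (hG : VeryWellCovered G) :
    ∃ f, IsPartner G f := by
  obtain ⟨hwc, hiso, hcard⟩ := hG
  obtain ⟨S, -, hS, hSc⟩ := exists_stable_card_eq_alphaOn G Finset.univ
  change S.card = alpha G at hSc
  obtain ⟨g, hg, hgN⟩ := (Finset.all_card_le_biUnion_card_iff_exists_injective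
    (fun s : S => Finset.univ.filter fun v => G.Adj s v)).1 (by
      intro A
      have h := hwc.card_le_card_neighbors hiso (A := A.map (Function.Embedding.subtype _))
        (hS.mono fun x hx => by
          obtain ⟨y, -, rfl⟩ := Finset.mem_map.1 hx
          exact y.2)
      rw [Finset.card_map] at h
      refine h.trans (Finset.card_le_card fun v hv => ?_)
      simp only [Finset.mem_filter, Finset.mem_map, Finset.mem_biUnion, Finset.mem_univ,
        true_and] at hv ⊢
      obtain ⟨_, ⟨u, hu, rfl⟩, huv⟩ := hv
      exact ⟨u, hu, huv⟩)
  simp only [Finset.mem_filter, Finset.mem_univ, true_and] at hgN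
  have hgS : ∀ s, g s ∉ S := fun s h => hS s.2 h (hgN s)
  have himg : Finset.univ.image g = Sᶜ := by
    refine Finset.eq_of_subset_of_card_le (fun v hv => ?_) ?_
    · obtain ⟨s, -, rfl⟩ := Finset.mem_image.1 hv
      simpa using hgS s
    · rw [Finset.card_image_of_injective _ hg, Finset.card_compl]
      simp
      omega
  have hsurj : ∀ v, v ∉ S → ∃ s, g s = v := fun v hv => by
    obtain ⟨s, -, hs⟩ := Finset.mem_image.1 (himg ▸ Finset.mem_compl.2 hv)
    exact ⟨s, hs⟩
  choose k hk using hsurj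
  refine ⟨fun v => if h : v ∈ S then g ⟨v, h⟩ else k v h, fun v => ?_, fun v => ?_⟩
  · by_cases h : v ∈ S
    · simp only [h, dite_true, hgS, dite_false]
      rw [hg (hk (g ⟨v, h⟩) (hgS _))]
    · simp [h, hk]
  · by_cases h : v ∈ S
    · simpa [h] using hgN ⟨v, h⟩
    · simpa [h, hk] using (hgN (k v h)).symm

/-- Every matching edge `{v, f v}` has an endpoint of degree one. -/
structure IsPendantPartner (G : SimpleGraph V) (f : V → V) : Prop extends IsPartner G f where
  pendant : ∀ v, (∀ u, G.Adj v u → u = f v) ∨ (∀ u, G.Adj (f v) u → u = v)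

section Partner

variable {G : SimpleGraph V} {f : V → V}

omit [Fintype V] [DecidableEq V] in
lemma IsPartner.injective (hf : IsPartner G f) : Function.Injective f :=
  Function.LeftInverse.injective hf.invol

omit [Fintype V] in
lemma IsPartner.card_le (hf : IsPartner G f) {T Y : Finset V} (hT : IsStable G T)
    (h : ∀ t ∈ T, t ∈ Y ∨ f t ∈ Y) : T.card ≤ Y.card := by
  refine Finset.card_le_card_of_injOn (fun t => if t ∈ Y then t else f t) ?_ ?_
  · intro t ht
    have := h t ht
    simp only [Finset.mem_coe]
    split_ifs <;> tauto
  · intro s hs t ht hst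
    simp only at hst
    split_ifs at hst
    · exact hst
    · exact (hT ht hs (hst ▸ hf.adj t)).elim
    · exact (hT hs ht (hst ▸ hf.adj s)).elim
    · exact hf.injective hst

lemma IsPartner.mem_or_mem (hf : IsPartner G f) {S : Finset V} (hS : IsStable G S)
    (hc : Fintype.card V = 2 * S.card) (v : V) : v ∈ S ∨ f v ∈ S := by
  have hd : Disjoint S (S.image f) := by
    rw [Finset.disjoint_left]
    intro x hx hx'
    obtain ⟨y, hy, rfl⟩ := Finset.mem_image.1 hx'
    exact hS hy hx (hf.adj y)
  have hu : S ∪ S.image f = Finset.univ := by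
    rw [← Finset.card_eq_iff_eq_univ, Finset.card_union_of_disjoint hd,
      Finset.card_image_of_injective _ hf.injective, hc, two_mul]
  have hv : v ∈ S ∪ S.image f := hu ▸ Finset.mem_univ v
  rcases Finset.mem_union.1 hv with h | h
  · exact Or.inl h
  · obtain ⟨y, hy, rfl⟩ := Finset.mem_image.1 h
    exact Or.inr (by rwa [hf.invol])

lemma IsPartner.isPendantPartner (hf : IsPartner G f) (hG : VeryWellCovered G)
    (hC4 : ∀ (v : V) (c : G.Walk v v), c.IsCycle → c.length ≠ 4) : IsPendantPartner G f := by
  refine ⟨hf, fun x => ?_⟩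
  by_contra! hcon
  obtain ⟨⟨a, hxa, ha⟩, b, hyb, hb⟩ := hcon
  have hab : G.Adj a b := by
    by_contra hab
    obtain ⟨S, hsub, hS, hSc⟩ := hG.1.exists_superset_card_eq_alpha (A := {a, b}) (by
      intro u hu v hv huv
      simp only [Finset.mem_insert, Finset.mem_singleton] at hu hv
      rcases hu with rfl | rfl <;> rcases hv with rfl | rfl
      · exact huv.ne rfl
      · exact hab huv
      · exact hab huv.symm
      · exact huv.ne rfl)
    rcases hf.mem_or_mem hS (hSc ▸ hG.2.2) x with h | h
    · exact hS h (hsub (by simp)) hxa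
    · exact hS h (hsub (by simp)) hyb
  have hxy := hf.adj x
  refine hC4 a (.cons hxa.symm (.cons hxy (.cons hyb (.cons hab.symm .nil)))) ?_ rfl
  rw [SimpleGraph.Walk.cons_isCycle_iff]
  have := hxy.ne
  have := hxa.ne
  have := hyb.ne
  have := hab.ne
  simp [SimpleGraph.Walk.cons_isPath_iff]
  grind

omit [Fintype V] [DecidableEq V] in
lemma IsPendantPartner.eq_of_adj_of_ne (hf : IsPendantPartner G f) {v w : V} (h : G.Adj v w)
    (hne : w ≠ f v) : ∀ u, G.Adj (f v) u → u = v :=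
  (hf.pendant v).resolve_left fun hl => hne (hl w h)

lemma IsPendantPartner.mem_Psi_iff (hf : IsPendantPartner G f) {S : Finset V} :
    S ∈ Psi G ↔ IsStable G S ∧ ∀ x ∈ S, ∀ w, G.Adj x w → f w ∈ S := by
  constructor
  · rintro ⟨hS, hc⟩
    refine ⟨hS, fun x hx w hxw => ?_⟩
    by_contra hfw
    have hwS : w ∉ S := fun h => hS hx h hxw
    let g : V → V := fun s => if G.Adj s w then f s else s
    have hpend : ∀ s ∈ S, G.Adj s w → ∀ u, G.Adj (f s) u → u = s := fun s hs hsw =>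
      hf.eq_of_adj_of_ne hsw fun h => hfw (by rwa [h, hf.invol])
    have hinj : Set.InjOn g S := by
      intro s hs t ht hst
      simp only [g] at hst
      split_ifs at hst
      · exact hf.injective hst
      · exact (hS hs ht (hst ▸ hf.adj s)).elim
      · exact (hS ht hs (hst ▸ hf.adj t)).elim
      · exact hst
    have hwg : w ∉ S.image g := by
      intro h
      obtain ⟨s, hs, hsw⟩ := Finset.mem_image.1 h
      simp only [g] at hsw
      split_ifs at hsw
      · exact hfw (by rwa [← hsw, hf.invol])
      · exact hwS (hsw ▸ hs)
    have hw : ∀ s ∈ S, ¬G.Adj (g s) w := by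
      intro s hs h
      simp only [g] at h
      split_ifs at h with hsw
      · exact hwS (hpend s hs hsw w h ▸ hs)
      · exact hsw h
    have hgg : ∀ s ∈ S, ∀ t ∈ S, G.Adj s w → ¬G.Adj (g s) (g t) := by
      intro s hs t ht hsw h
      have h1 : g s = f s := if_pos hsw
      have h2 : g t = s := hpend s hs hsw _ (h1 ▸ h)
      simp only [g] at h2
      split_ifs at h2
      · exact hS ht hs (h2 ▸ hf.adj t)
      · subst h2
        exact h.ne rfl
    have hst : IsStable G (insert w (S.image g)) := by
      intro a ha b hb hab
      simp only [Finset.mem_insert, Finset.mem_image] at ha hb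
      rcases ha with rfl | ⟨s, hs, rfl⟩ <;> rcases hb with rfl | ⟨t, ht, rfl⟩
      · exact hab.ne rfl
      · exact hw t ht hab.symm
      · exact hw s hs hab
      · by_cases hsw : G.Adj s w
        · exact hgg s hs t ht hsw hab
        by_cases htw : G.Adj t w
        · exact hgg t ht s hs htw hab.symm
        simp only [g, if_neg hsw, if_neg htw] at hab
        exact hS hs ht hab
    have hmem : ∀ s ∈ S, ∀ u, G.Adj s u → u ∈ closedNbhd G S := fun s hs u hsu => by
      simp only [closedNbhd, nbhd, Finset.mem_union, Finset.mem_filter, Finset.mem_univ, true_and]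
      exact Or.inr ⟨fun h => hS hs h hsu, s, hs, hsu⟩
    have hle := hst.card_le_alphaOn (A := closedNbhd G S) (by
      intro a ha
      simp only [Finset.mem_insert, Finset.mem_image] at ha
      rcases ha with rfl | ⟨s, hs, rfl⟩
      · exact hmem x hx _ hxw
      · simp only [g]
        split_ifs
        · exact hmem s hs _ (hf.adj s)
        · exact Finset.mem_union_left _ hs)
    rw [Finset.card_insert_of_notMem hwg, Finset.card_image_of_injOn hinj] at hle
    omega
  · rintro ⟨hS, h⟩
    refine ⟨hS, le_antisymm (hS.card_le_alphaOn Finset.subset_union_left) ?_⟩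
    obtain ⟨T, hTS, hT, hTc⟩ := exists_stable_card_eq_alphaOn G (closedNbhd G S)
    rw [← hTc]
    refine hf.card_le hT fun t ht => ?_
    have := hTS ht
    simp only [closedNbhd, nbhd, Finset.mem_union, Finset.mem_filter, Finset.mem_univ,
      true_and] at this
    rcases this with h' | ⟨-, u, hu, hut⟩
    · exact Or.inl h'
    · exact Or.inr (h u hu t hut)

lemma IsPendantPartner.accessibleFam_Psi (hf : IsPendantPartner G f) : AccessibleFam (Psi G) := by
  intro X hX hne
  rw [hf.mem_Psi_iff] at hX
  obtain ⟨hX, hcl⟩ := hX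
  obtain ⟨x, hx, hxX⟩ : ∃ x ∈ X, ∀ y ∈ X, G.Adj y (f x) → y = x := by
    by_cases h : ∃ x ∈ X, ∀ u, G.Adj (f x) u → u = x
    · obtain ⟨x, hx, h⟩ := h
      exact ⟨x, hx, fun y _ hy => h y hy.symm⟩
    · push Not at h
      obtain ⟨x, hx⟩ := Finset.nonempty_iff_ne_empty.2 hne
      refine ⟨x, hx, fun y hy hyx => ?_⟩
      obtain ⟨u, hu, hne⟩ := h y hy
      have hl := (hf.pendant y).resolve_right fun h' => hne (h' u hu)
      exact hf.injective (hl _ hyx).symm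
  refine ⟨x, hx, hf.mem_Psi_iff.2 ⟨hX.mono (Finset.erase_subset _ _), fun y hy w hyw => ?_⟩⟩
  rw [Finset.mem_erase] at hy ⊢
  refine ⟨fun hw => hy.1 (hxX y hy.2 ?_), hcl y hy.2 w hyw⟩
  rwa [← hw, hf.invol]

lemma IsPendantPartner.exchangeFam_Psi (hf : IsPendantPartner G f) : ExchangeFam (Psi G) := by
  intro X hX Y hY hc
  rw [hf.mem_Psi_iff] at hX hY
  obtain ⟨hX, hXcl⟩ := hX
  obtain ⟨hY, hYcl⟩ := hY
  have key : ∀ x ∈ X, x ∉ Y → f x ∉ Y →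
      (∀ w, G.Adj x w → f w ∈ insert x Y) → ∃ x ∈ X, x ∉ Y ∧ insert x Y ∈ Psi G := by
    intro x hxX hxY hfx hw
    have hxY' : ∀ y ∈ Y, ¬G.Adj y x := fun y hy h => hfx (hYcl y hy x h)
    refine ⟨x, hxX, hxY, hf.mem_Psi_iff.2 ⟨fun a ha b hb hab => ?_, fun a ha w haw => ?_⟩⟩
    · rw [Finset.mem_insert] at ha hb
      rcases ha with rfl | ha <;> rcases hb with rfl | hb
      · exact hab.ne rfl
      · exact hxY' b hb hab.symm
      · exact hxY' a ha hab
      · exact hY ha hb hab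
    · rcases Finset.mem_insert.1 ha with rfl | ha
      · exact hw w haw
      · exact Finset.mem_insert_of_mem (hYcl a ha w haw)
  by_cases hleaf : ∃ x ∈ X, x ∉ Y ∧ f x ∉ Y ∧ ∀ u, G.Adj x u → u = f x
  · obtain ⟨x, hxX, hxY, hfx, hl⟩ := hleaf
    exact key x hxX hxY hfx fun w hw => by simp [hl w hw, hf.invol]
  obtain ⟨x, hxX, hxY, hfx⟩ : ∃ x ∈ X, x ∉ Y ∧ f x ∉ Y := by
    by_contra! h
    have := hf.card_le hX (Y := Y) fun t ht => or_iff_not_imp_left.2 (h t ht)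
    omega
  refine key x hxX hxY hfx fun w hw => ?_
  by_cases hwx : w = f x
  · simp [hwx, hf.invol]
  refine Finset.mem_insert_of_mem (by_contra fun hfw => hleaf ⟨f w, hXcl x hxX w hw, hfw, ?_, ?_⟩)
  · rw [hf.invol]
    exact fun hwY => hfx (hYcl w hwY x hw.symm)
  · rw [hf.invol]
    exact hf.eq_of_adj_of_ne hw.symm fun h => hwx (by rw [h, hf.invol])

lemma IsPendantPartner.isGreedoidFam_Psi (hf : IsPendantPartner G f) : IsGreedoidFam (Psi G) :=
  ⟨⟨∅, hf.mem_Psi_iff.2 ⟨by simp [IsStable], by simp⟩⟩, hf.accessibleFam_Psi, hf.exchangeFam_Psi⟩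

end Partner

section Matchings

variable {G : SimpleGraph V} {f : V → V}

omit [Fintype V] in
lemma IsGMatching.two_mul_card {M : Finset (Sym2 V)} (hM : IsGMatching G M) :
    2 * M.card = (M.biUnion Sym2.toFinset).card := by
  rw [Finset.card_biUnion, Finset.sum_congr rfl fun e he =>
    Sym2.card_toFinset_of_not_isDiag e (G.not_isDiag_of_mem_edgeSet (hM.1 e he)),
    Finset.sum_const, smul_eq_mul, mul_comm]
  intro e he e' he' hne
  rw [Function.onFun, Finset.disjoint_left]
  intro v hv hv'
  rw [Sym2.mem_toFinset] at hv hv'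
  exact hM.2 e he e' he' hne v hv hv'

lemma IsPartner.isGMatching_image (hf : IsPartner G f) :
    IsGMatching G (Finset.univ.image fun v => s(v, f v)) := by
  constructor
  · intro e he
    obtain ⟨v, -, rfl⟩ := Finset.mem_image.1 he
    exact hf.adj v
  · intro e he e' he' hne v hv hv'
    obtain ⟨a, -, rfl⟩ := Finset.mem_image.1 he
    obtain ⟨b, -, rfl⟩ := Finset.mem_image.1 he'
    have h : ∀ a, v ∈ s(a, f a) → s(a, f a) = s(v, f v) := by
      intro a ha
      rcases Sym2.mem_iff.1 ha with rfl | rfl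
      · rfl
      · rw [hf.invol, Sym2.eq_swap]
    exact hne ((h a hv).trans (h b hv').symm)

lemma IsPartner.two_mul_card_image (hf : IsPartner G f) :
    2 * (Finset.univ.image fun v => s(v, f v)).card = Fintype.card V := by
  rw [hf.isGMatching_image.two_mul_card, Finset.card_eq_iff_eq_univ, Finset.eq_univ_iff_forall]
  intro v
  exact Finset.mem_biUnion.2 ⟨s(v, f v), Finset.mem_image_of_mem _ (Finset.mem_univ v), by simp⟩

lemma IsPartner.mu_eq (hf : IsPartner G f) :
    mu G = (Finset.univ.image fun v => s(v, f v)).card := by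
  have hub : ∀ n ∈ {n | ∃ M, IsGMatchingOn G Finset.univ M ∧ M.card = n},
      n ≤ (Finset.univ.image fun v => s(v, f v)).card := by
    rintro n ⟨M, hM, rfl⟩
    have h1 := hM.1.two_mul_card
    have h2 := Finset.card_le_univ (M.biUnion Sym2.toFinset)
    have h3 := hf.two_mul_card_image
    omega
  have hmem : (Finset.univ.image fun v => s(v, f v)).card ∈
      {n | ∃ M, IsGMatchingOn G Finset.univ M ∧ M.card = n} :=
    ⟨_, ⟨hf.isGMatching_image, by simp⟩, rfl⟩
  exact le_antisymm (csSup_le ⟨_, hmem⟩ hub) (le_csSup ⟨_, hub⟩ hmem)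

lemma IsPendantPartner.existsUnique_isMaximumGMatching (hf : IsPendantPartner G f) :
    ∃! M : Finset (Sym2 V), IsMaximumGMatching G M := by
  refine ⟨Finset.univ.image fun v => s(v, f v), ⟨hf.isGMatching_image, hf.mu_eq.symm⟩, ?_⟩
  rintro M ⟨hM, hMc⟩
  rw [hf.mu_eq] at hMc
  have hsat : ∀ v, ∃ e ∈ M, v ∈ e := by
    have : M.biUnion Sym2.toFinset = Finset.univ := by
      rw [← Finset.card_eq_iff_eq_univ, ← hM.two_mul_card, hMc, hf.two_mul_card_image]
    intro v
    have hv : v ∈ M.biUnion Sym2.toFinset := this ▸ Finset.mem_univ v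
    simpa using hv
  have hpend : ∀ v, (∀ u, G.Adj v u → u = f v) → s(v, f v) ∈ M := by
    intro v hv
    obtain ⟨e, he, u, rfl⟩ := hsat v
    have hu : u = f v := hv u (hM.1 _ he)
    rwa [hu] at he
  refine (Finset.eq_of_subset_of_card_le (fun e he => ?_) hMc.le).symm
  obtain ⟨v, -, rfl⟩ := Finset.mem_image.1 he
  rcases hf.pendant v with h | h
  · exact hpend v h
  · have := hpend (f v) (by rwa [hf.invol])
    rwa [hf.invol, Sym2.eq_swap] at this

end Matchings

/-- Every very well-covered graph with no cycle of length four has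
a unique maximum matching and, consequently, `Ψ(G)` is a greedoid. -/
theorem c4_free_vwc_unique_max_matching_and_greedoid (G : SimpleGraph V)
    (hG : VeryWellCovered G)
    (hC4 : ∀ (v : V) (c : G.Walk v v), c.IsCycle → c.length ≠ 4) :
    (∃! M : Finset (Sym2 V), IsMaximumGMatching G M) ∧ IsGreedoidFam (Psi G) := by
  obtain ⟨f, hf⟩ := hG.exists_isPartner
  have hp := hf.isPendantPartner hG hC4
  exact ⟨hp.existsUnique_isMaximumGMatching, hp.isGreedoidFam_Psi⟩
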